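/- For every semantics sem ∈ {grounded, complete, preferred, stable} and every formula φ: A ∪ S |~^⋒_sem φ holds in the ABA-framework (every sem-extension contains some argument whose conclusion is φ) if and only if A ∪ S |~^⋒_sem φ holds in the corresponding sequent-based ABA-framework (every sem-extension contains some assumptive sequent argument with conclusion φ). -/

import Mathlib

/-- A rule `φ₁,…,φₙ → φ` of a deductive system: premises and a conclusion. -/
abbrev Rule (F : Type) := List F × F

/-- Deducibility `Γ ⊢^R φ`: chaining rules of `R` from members of `Γ`. -/
inductive Ded {F : Type} (R : Set (Rule F)) (Γ : Set F) : F → Prop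
  | mem {φ : F} : φ ∈ Γ → Ded R Γ φ
  | app {l : List F} {φ : F} : (l, φ) ∈ R → (∀ ψ ∈ l, Ded R Γ ψ) → Ded R Γ φ

/-- Derivability of assumptive sequents `A' ⟨ Γ ⇒ Δ` in the calculus `R_⇒`:
the sequents `μ(r)` for `r ∈ R`, the identity axiom, the two cut rules, and the
rules `AS_ABA` moving a formula of the assumption set `AS` between the
assumption component and the left-hand side of `⇒`. -/
inductive SeqDer {F : Type} [DecidableEq F] (R : Set (Rule F)) (AS : Set F) :
    Finset F → Finset F → Finset F → Prop
  | id (φ : F) : SeqDer R AS ∅ {φ} {φ}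
  | mu {l : List F} {φ : F} : (l, φ) ∈ R → SeqDer R AS ∅ l.toFinset {φ}
  | cutLhs {A₁ A₂ Γ₁ Γ₂ Δ₁ Δ₂ : Finset F} {φ : F} :
      SeqDer R AS A₁ Γ₁ (insert φ Δ₁) → SeqDer R AS A₂ (insert φ Γ₂) Δ₂ →
      SeqDer R AS (A₁ ∪ A₂) (Γ₁ ∪ Γ₂) (Δ₁ ∪ Δ₂)
  | cutAss {A₁ A₂ Γ₁ Γ₂ Δ₁ Δ₂ : Finset F} {φ : F} :
      SeqDer R AS A₁ Γ₁ (insert φ Δ₁) → SeqDer R AS (insert φ A₂) Γ₂ Δ₂ →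
      SeqDer R AS (A₁ ∪ A₂) (Γ₁ ∪ Γ₂) (Δ₁ ∪ Δ₂)
  | toAss {A' Γ Δ : Finset F} {φ : F} :
      φ ∈ AS → SeqDer R AS A' (insert φ Γ) Δ → SeqDer R AS (insert φ A') Γ Δ
  | toLhs {A' Γ Δ : Finset F} {φ : F} :
      φ ∈ AS → SeqDer R AS (insert φ A') Γ Δ → SeqDer R AS A' (insert φ Γ) Δ

/-- An argument: an assumption component, a support (strict premises) and a conclusion. -/
structure Argu (F : Type) where
  ass : Finset F
  supp : Finset F
  concl : F

/-- `a` is an ABA-argument based on `S` and `A`: a deduction `ass(a) ∪ supp(a) ⊢^R conc(a)`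
with finite `ass(a) ⊆ A` and finite `supp(a) ⊆ S`. -/
def IsABAArg {F : Type} (R : Set (Rule F)) (S A : Set F) (a : Argu F) : Prop :=
  ↑a.ass ⊆ A ∧ ↑a.supp ⊆ S ∧ Ded R (↑a.ass ∪ ↑a.supp) a.concl

/-- `a` is an assumptive sequent argument based on `S` and `A`: a sequent
`ass(a) ⟨ supp(a) ⇒ conc(a)` derivable in `R_⇒`, with `ass(a) ⊆ A` and `supp(a) ⊆ S`. -/
def IsSeqArg {F : Type} [DecidableEq F] (R : Set (Rule F)) (S A : Set F) (a : Argu F) : Prop :=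
  ↑a.ass ⊆ A ∧ ↑a.supp ⊆ S ∧ SeqDer R A a.ass a.supp {a.concl}

/-- `a` attacks `b` iff the conclusion of `a` is the contrary of some assumption of `b`
(this is the ABA attack, and also the sequent-based `AT_ABA` attack). -/
def Attacks {F : Type} (contrary : F → F) (a b : Argu F) : Prop :=
  ∃ ψ ∈ b.ass, a.concl = contrary ψ

/-- `E` is conflict-free: a set of arguments of the framework no member of which attacks a member. -/
def ConflictFree {α : Type} (Args : Set α) (att : α → α → Prop) (E : Set α) : Prop :=
  E ⊆ Args ∧ ∀ a ∈ E, ∀ b ∈ E, ¬ att a b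

/-- `E` defends `a`: `E` attacks every attacker of `a`. -/
def Defends {α : Type} (Args : Set α) (att : α → α → Prop) (E : Set α) (a : α) : Prop :=
  ∀ b ∈ Args, att b a → ∃ c ∈ E, att c b

/-- `E` is admissible: conflict-free and defending all of its elements. -/
def Admissible {α : Type} (Args : Set α) (att : α → α → Prop) (E : Set α) : Prop :=
  ConflictFree Args att E ∧ ∀ a ∈ E, Defends Args att E a

/-- A complete extension: an admissible set containing every argument it defends. -/
def CompleteExt {α : Type} (Args : Set α) (att : α → α → Prop) (E : Set α) : Prop :=
  Admissible Args att E ∧ ∀ a ∈ Args, Defends Args att E a → a ∈ E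

/-- The grounded extension: the ⊆-minimal complete extension. -/
def GroundedExt {α : Type} (Args : Set α) (att : α → α → Prop) (E : Set α) : Prop :=
  CompleteExt Args att E ∧ ∀ E', CompleteExt Args att E' → E ⊆ E'

/-- A preferred extension: a ⊆-maximal complete extension. -/
def PreferredExt {α : Type} (Args : Set α) (att : α → α → Prop) (E : Set α) : Prop :=
  CompleteExt Args att E ∧ ∀ E', CompleteExt Args att E' → E ⊆ E' → E' = E

/-- A set `A'` of assumptions is consistent iff there is no `φ ∈ A'` with
`A'' ∪ Γ ⊢^R φ̄` for some `A'' ⊆ A'` and `Γ ⊆ S`. -/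
def ConsistentSet {F : Type} (R : Set (Rule F)) (contrary : F → F) (S : Set F)
    (A' : Set F) : Prop :=
  ¬ ∃ φ ∈ A', ∃ A'' ⊆ A', ∃ Γ ⊆ S, Ded R (A'' ∪ Γ) (contrary φ)

/-- `MCS(S,A)`: the set of ⊆-maximal consistent subsets of `A`. -/
def MCS {F : Type} (R : Set (Rule F)) (contrary : F → F) (S A : Set F) : Set (Set F) :=
  {T | T ⊆ A ∧ ConsistentSet R contrary S T ∧
    ∀ T', T ⊆ T' → T' ⊆ A → ConsistentSet R contrary S T' → T' = T}

/-- `CN(T) = {φ | Γ ⊢^R φ for some Γ ⊆ T}`. -/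
def CN {F : Type} (R : Set (Rule F)) (T : Set F) : Set F :=
  {φ | ∃ Γ ⊆ T, Ded R Γ φ}

/-- `⊢^R` is contrapositive for assumptions: for all `φ, ψ` in an assumption set `A'`
and `Γ ⊆ S`, `A' ∪ Γ ⊢^R ψ̄` iff `(A' \ {φ}) ∪ {ψ} ∪ Γ ⊢^R φ̄`. -/
def Contrapositive {F : Type} (R : Set (Rule F)) (contrary : F → F) (S A : Set F) : Prop :=
  ∀ A' ⊆ A, ∀ Γ ⊆ S, ∀ φ ∈ A', ∀ ψ ∈ A',
    (Ded R (A' ∪ Γ) (contrary ψ) ↔ Ded R ((A' \ {φ}) ∪ {ψ} ∪ Γ) (contrary φ))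

/-- A stable extension: a complete extension attacking every argument not in it. -/
def StableExt {α : Type} (Args : Set α) (att : α → α → Prop) (E : Set α) : Prop :=
  CompleteExt Args att E ∧ ∀ a ∈ Args, a ∉ E → ∃ b ∈ E, att b a

/-- The four semantics: grounded, complete, preferred and stable. -/
inductive Sem | grd | cmp | prf | stb

/-- The extensions of a framework under a semantics. -/
def ExtOf {α : Type} (Args : Set α) (att : α → α → Prop) : Sem → Set α → Prop
  | .grd => GroundedExt Args att
  | .cmp => CompleteExt Args att
  | .prf => PreferredExt Args att
  | .stb => StableExt Args att

section Sequents

variable {F : Type} {R : Set (Rule F)}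

theorem Ded.trans {Γ Γ' : Set F} {φ : F} (h : Ded R Γ φ) (hΓ : ∀ ψ ∈ Γ, Ded R Γ' ψ) :
    Ded R Γ' φ := by
  induction h with
  | mem hm => exact hΓ _ hm
  | app hr _ ih => exact .app hr ih

theorem Ded.mono {Γ Γ' : Set F} {φ : F} (h : Ded R Γ φ) (hΓ : Γ ⊆ Γ') : Ded R Γ' φ :=
  h.trans fun _ hψ => .mem (hΓ hψ)

variable [DecidableEq F]

/-- Soundness of `R_⇒`: the right-hand side is read disjunctively. -/
theorem SeqDer.exists_ded {A : Set F} {B Γ Δ : Finset F} (h : SeqDer R A B Γ Δ) :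
    ∃ δ ∈ Δ, Ded R (↑B ∪ ↑Γ) δ := by
  have cut : ∀ {T₁ T₂ T : Set F} {Δ₁ Δ₂ : Finset F} {φ : F}, T₁ ⊆ T → T₂ ⊆ insert φ T →
      (∃ δ ∈ insert φ Δ₁, Ded R T₁ δ) → (∃ δ ∈ Δ₂, Ded R T₂ δ) →
      ∃ δ ∈ Δ₁ ∪ Δ₂, Ded R T δ := by
    rintro T₁ T₂ T Δ₁ Δ₂ φ h₁ h₂ ⟨δ, hδ, hd⟩ ⟨ε, hε, he⟩
    rcases Finset.mem_insert.1 hδ with rfl | hδ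
    · refine ⟨ε, Finset.mem_union_right _ hε, he.trans fun ψ hψ => ?_⟩
      rcases h₂ hψ with rfl | hψ
      exacts [hd.mono h₁, .mem hψ]
    · exact ⟨δ, Finset.mem_union_left _ hδ, hd.mono h₁⟩
  induction h with
  | id φ => exact ⟨φ, by simp, .mem (by simp)⟩
  | mu hr => exact ⟨_, by simp, .app hr fun ψ hψ => .mem (by simpa using hψ)⟩
  | cutLhs _ _ ih₁ ih₂ =>
    exact cut (fun x => by simp; tauto) (fun x => by simp; tauto) ih₁ ih₂
  | cutAss _ _ ih₁ ih₂ =>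
    exact cut (fun x => by simp; tauto) (fun x => by simp; tauto) ih₁ ih₂
  | toAss _ _ ih =>
    obtain ⟨δ, hδ, hd⟩ := ih
    exact ⟨δ, hδ, hd.mono fun x => by simp; tauto⟩
  | toLhs _ _ ih =>
    obtain ⟨δ, hδ, hd⟩ := ih
    exact ⟨δ, hδ, hd.mono fun x => by simp; tauto⟩

theorem SeqDer.cut_list {A : Set F} {T : Set F} {φ : F} (l : List F)
    (hl : ∀ ψ ∈ l, ∃ Γ : Finset F, ↑Γ ⊆ T ∧ SeqDer R A ∅ Γ {ψ}) (Γ : Finset F) (hΓ : ↑Γ ⊆ T)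
    (h : SeqDer R A ∅ (l.toFinset ∪ Γ) {φ}) :
    ∃ Γ : Finset F, ↑Γ ⊆ T ∧ SeqDer R A ∅ Γ {φ} := by
  induction l generalizing Γ with
  | nil => exact ⟨Γ, hΓ, by simpa using h⟩
  | cons ψ l ih =>
    obtain ⟨Γ₁, h₁, hd₁⟩ := hl ψ (by simp)
    refine ih (fun χ hχ => hl χ (by simp [hχ])) (Γ₁ ∪ Γ) (by simp [h₁, hΓ]) ?_
    have h' : SeqDer R A ∅ (insert ψ (l.toFinset ∪ Γ)) {φ} := by
      simpa [Finset.insert_union] using h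
    have := SeqDer.cutLhs (Δ₁ := ∅) (by simpa using hd₁) h'
    rw [Finset.union_left_comm]
    simpa using this

theorem Ded.exists_seqDer (A : Set F) {T : Set F} {φ : F} (h : Ded R T φ) :
    ∃ Γ : Finset F, ↑Γ ⊆ T ∧ SeqDer R A ∅ Γ {φ} := by
  induction h with
  | @mem φ hm => exact ⟨{φ}, by simpa using hm, .id φ⟩
  | @app l φ hr _ ih =>
    exact SeqDer.cut_list l ih ∅ (by simp) (by simpa using SeqDer.mu hr)

theorem SeqDer.move_to_ass {A : Set F} {Δ : Finset F} (M B Γ : Finset F) (hM : ↑M ⊆ A)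
    (h : SeqDer R A B (M ∪ Γ) Δ) : SeqDer R A (M ∪ B) Γ Δ := by
  induction M using Finset.induction_on generalizing B with
  | empty => simpa using h
  | insert φ M _ ih =>
    rw [Finset.coe_insert, Set.insert_subset_iff] at hM
    rw [Finset.insert_union] at h
    have := ih (insert φ B) hM.2 (.toAss hM.1 h)
    rwa [Finset.union_insert, ← Finset.insert_union] at this

theorem IsSeqArg.isABAArg {S A : Set F} {a : Argu F} (h : IsSeqArg R S A a) :
    IsABAArg R S A a := by
  obtain ⟨δ, hδ, hd⟩ := h.2.2.exists_ded
  rw [Finset.mem_singleton] at hδ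
  exact ⟨h.1, h.2.1, hδ ▸ hd⟩

theorem IsABAArg.exists_isSeqArg {S A : Set F} (hSA : S ∩ A = ∅) {a : Argu F}
    (h : IsABAArg R S A a) :
    ∃ b, IsSeqArg R S A b ∧ b.ass ⊆ a.ass ∧ b.concl = a.concl := by
  classical
  obtain ⟨hass, hsupp, hd⟩ := h
  obtain ⟨Γ, hΓ, hs⟩ := hd.exists_seqDer A
  have hmem : ∀ x ∈ Γ, x ∈ a.ass ∨ x ∈ S := fun x hx =>
    (hΓ hx).imp id fun h => hsupp h
  have hsub : Γ.filter (· ∈ A) ⊆ a.ass := fun x hx => by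
    rw [Finset.mem_filter] at hx
    refine (hmem x hx.1).resolve_right fun hS => ?_
    exact (hSA ▸ (⟨hS, hx.2⟩ : x ∈ S ∩ A) : x ∈ (∅ : Set F))
  refine ⟨⟨Γ.filter (· ∈ A), Γ.filter (· ∉ A), a.concl⟩, ⟨?_, ?_, ?_⟩, hsub, rfl⟩
  · exact fun x hx => (Finset.mem_filter.1 hx).2
  · intro x hx
    obtain ⟨hx, hxA⟩ := Finset.mem_filter.1 hx
    exact (hmem x hx).resolve_left fun h => hxA (hass h)
  · have := SeqDer.move_to_ass (R := R) (A := A) (Δ := {a.concl}) (Γ.filter (· ∈ A)) ∅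
      (Γ.filter (· ∉ A)) (fun x hx => (Finset.mem_filter.1 hx).2)
      (by rwa [Finset.filter_union_filter_not_eq])
    simpa using this

end Sequents

section Frameworks

variable {α : Type}

/-- Every member of `X` is dominated by a member of `Y ⊆ X` that attacks at least as much,
is attacked at most as much, and has the same conclusion. -/
structure Reduces {β : Type} (X Y : Set α) (att : α → α → Prop) (concl : α → β) : Prop where
  subset : Y ⊆ X
  exists_reduct : ∀ a ∈ X, ∃ b ∈ Y,
    (∀ c, att a c → att b c) ∧ (∀ c, att c b → att c a) ∧ concl b = concl a

/-- The arguments of `X` defended by `E` against attackers in `Y`. -/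
def liftExt (X Y : Set α) (att : α → α → Prop) (E : Set α) : Set α :=
  {a | a ∈ X ∧ Defends Y att E a}

theorem liftExt_mono {X Y : Set α} {att : α → α → Prop} {E E' : Set α} (h : E ⊆ E') :
    liftExt X Y att E ⊆ liftExt X Y att E' := fun _ ha =>
  ⟨ha.1, fun b hb hba => let ⟨c, hc, hcb⟩ := ha.2 b hb hba; ⟨c, h hc, hcb⟩⟩

namespace Reduces

variable {β : Type} {X Y : Set α} {att : α → α → Prop} {concl : α → β}

theorem exists_reduct_mem (h : Reduces X Y att concl) {E : Set α} (hE : CompleteExt X att E)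
    {a : α} (ha : a ∈ E) : ∃ b ∈ E ∩ Y, (∀ c, att a c → att b c) ∧ concl b = concl a := by
  obtain ⟨b, hb, hout, hin, hc⟩ := h.exists_reduct a (hE.1.1.1 ha)
  exact ⟨b, ⟨hE.2 b (h.subset hb) fun d hd hdb => hE.1.2 a ha d hd (hin d hdb), hb⟩, hout, hc⟩

theorem defends_iff (h : Reduces X Y att concl) {E : Set α} {a : α} :
    Defends X att E a ↔ Defends Y att E a := by
  refine ⟨fun hd b hb => hd b (h.subset hb), fun hd b hb hba => ?_⟩
  obtain ⟨b', hb', hout, hin, -⟩ := h.exists_reduct b hb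
  obtain ⟨c, hc, hcb⟩ := hd b' hb' (hout a hba)
  exact ⟨c, hc, hin c hcb⟩

theorem defends_inter_iff (h : Reduces X Y att concl) {E : Set α} (hE : CompleteExt X att E)
    {a : α} : Defends Y att (E ∩ Y) a ↔ Defends X att E a := by
  rw [h.defends_iff]
  refine ⟨fun hd b hb hba => ?_, fun hd b hb hba => ?_⟩
  · obtain ⟨c, hc, hcb⟩ := hd b hb hba
    exact ⟨c, hc.1, hcb⟩
  · obtain ⟨c, hc, hcb⟩ := hd b hb hba
    obtain ⟨c', hc', hout, -⟩ := h.exists_reduct_mem hE hc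
    exact ⟨c', hc', hout b hcb⟩

theorem completeExt_inter (h : Reduces X Y att concl) {E : Set α} (hE : CompleteExt X att E) :
    CompleteExt Y att (E ∩ Y) :=
  ⟨⟨⟨Set.inter_subset_right, fun a ha b hb => hE.1.1.2 a ha.1 b hb.1⟩,
    fun a ha => (h.defends_inter_iff hE).2 (hE.1.2 a ha.1)⟩,
    fun a ha hd => ⟨hE.2 a (h.subset ha) ((h.defends_inter_iff hE).1 hd), ha⟩⟩

theorem liftExt_inter (h : Reduces X Y att concl) {E : Set α} (hE : CompleteExt X att E) :
    liftExt X Y att (E ∩ Y) = E := by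
  ext a
  exact ⟨fun ha => hE.2 a ha.1 ((h.defends_inter_iff hE).1 ha.2),
    fun ha => ⟨hE.1.1.1 ha, (h.defends_inter_iff hE).2 (hE.1.2 a ha)⟩⟩

theorem subset_liftExt (h : Reduces X Y att concl) {E : Set α} (hE : CompleteExt Y att E) :
    E ⊆ liftExt X Y att E := fun a ha => ⟨h.subset (hE.1.1.1 ha), hE.1.2 a ha⟩

theorem inter_liftExt (h : Reduces X Y att concl) {E : Set α} (hE : CompleteExt Y att E) :
    liftExt X Y att E ∩ Y = E := by
  ext a
  exact ⟨fun ha => hE.2 a ha.2 ha.1.2, fun ha => ⟨h.subset_liftExt hE ha, hE.1.1.1 ha⟩⟩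

theorem exists_reduct_liftExt (h : Reduces X Y att concl) {E : Set α}
    (hE : CompleteExt Y att E) {a : α} (ha : a ∈ liftExt X Y att E) :
    ∃ b ∈ E, ∀ c, att a c → att b c := by
  obtain ⟨b, hb, hout, hin, -⟩ := h.exists_reduct a ha.1
  exact ⟨b, hE.2 b hb fun d hd hdb => ha.2 d hd (hin d hdb), hout⟩

theorem completeExt_liftExt (h : Reduces X Y att concl) {E : Set α}
    (hE : CompleteExt Y att E) : CompleteExt X att (liftExt X Y att E) := by
  refine ⟨⟨⟨fun a ha => ha.1, fun a ha b hb hab => ?_⟩, fun a ha => ?_⟩, fun a ha hd => ⟨ha, ?_⟩⟩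
  · obtain ⟨a', ha', hout⟩ := h.exists_reduct_liftExt hE ha
    obtain ⟨c, hc, hca⟩ := hb.2 a' (hE.1.1.1 ha') (hout b hab)
    exact hE.1.1.2 c hc a' ha' hca
  · refine h.defends_iff.2 fun b hb hba => ?_
    obtain ⟨c, hc, hcb⟩ := ha.2 b hb hba
    exact ⟨c, h.subset_liftExt hE hc, hcb⟩
  · intro b hb hba
    obtain ⟨c, hc, hcb⟩ := hd b (h.subset hb) hba
    obtain ⟨c', hc', hout⟩ := h.exists_reduct_liftExt hE hc
    exact ⟨c', hc', hout b hcb⟩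

theorem extOf_inter (h : Reduces X Y att concl) {sem : Sem} {E : Set α}
    (hE : ExtOf X att sem E) : ExtOf Y att sem (E ∩ Y) := by
  cases sem with
  | cmp => exact h.completeExt_inter hE
  | grd =>
    refine ⟨h.completeExt_inter hE.1, fun E' hE' => ?_⟩
    rw [← h.inter_liftExt hE']
    exact Set.inter_subset_inter_left _ (hE.2 _ (h.completeExt_liftExt hE'))
  | prf =>
    refine ⟨h.completeExt_inter hE.1, fun E' hE' hsub => ?_⟩
    have hle := liftExt_mono (X := X) (Y := Y) (att := att) hsub
    rw [h.liftExt_inter hE.1] at hle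
    rw [← h.inter_liftExt hE', hE.2 _ (h.completeExt_liftExt hE') hle]
  | stb =>
    refine ⟨h.completeExt_inter hE.1, fun a ha hna => ?_⟩
    obtain ⟨b, hb, hba⟩ := hE.2 a (h.subset ha) fun hE => hna ⟨hE, ha⟩
    obtain ⟨b', hb', hout, -⟩ := h.exists_reduct_mem hE.1 hb
    exact ⟨b', hb', hout a hba⟩

theorem extOf_liftExt (h : Reduces X Y att concl) {sem : Sem} {E : Set α}
    (hE : ExtOf Y att sem E) : ExtOf X att sem (liftExt X Y att E) := by
  cases sem with
  | cmp => exact h.completeExt_liftExt hE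
  | grd =>
    refine ⟨h.completeExt_liftExt hE.1, fun E' hE' => ?_⟩
    rw [← h.liftExt_inter hE']
    exact liftExt_mono (hE.2 _ (h.completeExt_inter hE'))
  | prf =>
    refine ⟨h.completeExt_liftExt hE.1, fun E' hE' hsub => ?_⟩
    have hle := Set.inter_subset_inter_left Y hsub
    rw [h.inter_liftExt hE.1] at hle
    rw [← h.liftExt_inter hE', hE.2 _ (h.completeExt_inter hE') hle]
  | stb =>
    refine ⟨h.completeExt_liftExt hE.1, fun a ha hna => ?_⟩
    by_contra hno
    refine hna ⟨ha, fun b hb hba => ?_⟩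
    exact hE.2 b hb fun hbE => hno ⟨b, h.subset_liftExt hE.1 hbE, hba⟩

end Reduces

theorem ExtOf.completeExt {X : Set α} {att : α → α → Prop} {sem : Sem} {E : Set α}
    (h : ExtOf X att sem E) : CompleteExt X att E := by
  cases sem with
  | cmp => exact h
  | grd | prf | stb => exact h.1

theorem Reduces.skeptical_iff {β : Type} {X Y : Set α} {att : α → α → Prop} {concl : α → β}
    (h : Reduces X Y att concl) (sem : Sem) (φ : β) :
    (∀ E, ExtOf X att sem E → ∃ a ∈ E, concl a = φ) ↔
      (∀ E, ExtOf Y att sem E → ∃ a ∈ E, concl a = φ) := by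
  refine ⟨fun H E hE => ?_, fun H E hE => ?_⟩
  · have hL := h.extOf_liftExt hE
    obtain ⟨a, ha, rfl⟩ := H _ hL
    obtain ⟨b, hb, -, hc⟩ := h.exists_reduct_mem hL.completeExt ha
    rw [h.inter_liftExt hE.completeExt] at hb
    exact ⟨b, hb, hc⟩
  · obtain ⟨a, ha, hc⟩ := H _ (h.extOf_inter hE)
    exact ⟨a, ha.1, hc⟩

end Frameworks

theorem reduces_isABAArg_isSeqArg {F : Type} [DecidableEq F] {R : Set (Rule F)} {S A : Set F}
    (contrary : F → F) (hSA : S ∩ A = ∅) :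
    Reduces {a | IsABAArg R S A a} {a | IsSeqArg R S A a} (Attacks contrary) Argu.concl where
  subset _ ha := IsSeqArg.isABAArg ha
  exists_reduct a ha := by
    obtain ⟨b, hb, hass, hc⟩ := IsABAArg.exists_isSeqArg hSA ha
    exact ⟨b, hb, fun c ⟨ψ, hψ, h⟩ => ⟨ψ, hψ, hc.trans h⟩,
      fun c ⟨ψ, hψ, h⟩ => ⟨ψ, hass hψ, h⟩, hc⟩

/-- Weakly skeptical (⋒) entailment agrees between the ABA-framework and the
corresponding sequent-based ABA-framework, under each of the four semantics: every
sem-extension of the ABA-framework contains some argument with conclusion `φ` iff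
every sem-extension of the sequent-based framework contains some assumptive
sequent argument with conclusion `φ`. -/
theorem stmt4 {F V : Type} [DecidableEq F]
    (R : Set (Rule F)) (S A : Set F) (contrary : F → F) (atoms : F → Set V)
    (hA : A.Nonempty) (hSA : S ∩ A = ∅)
    (hNT : ∀ φ : F, (∀ s ∈ S, Disjoint (atoms φ) (atoms s)) → ¬ Ded R S φ)
    (sem : Sem) (φ : F) :
    (∀ E, ExtOf {a | IsABAArg R S A a} (Attacks contrary) sem E →
        ∃ a ∈ E, a.concl = φ) ↔
    (∀ E, ExtOf {a | IsSeqArg R S A a} (Attacks contrary) sem E →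
        ∃ a ∈ E, a.concl = φ) := by
  exact (reduces_isABAArg_isSeqArg contrary hSA).skeptical_iff sem φ
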